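/- Let k ≥ 6 be even, let s, w ∈ ℂ satisfy 2 < Re(s) < k−2 and Re(w) < min{Re(s)−1, k−1−Re(s)}, and let z = (z₁,z₂) ∈ ℍ². Then the summand of the double Eisenstein series, namely (γ,δ) ↦ σ₁(c)^{w−1}·σ₂(c)^{w−1}·(j(γ,z)/j(δ,z))^{−s·1}·j(δ,z)^{−k·1} with c = c_{γδ⁻¹}, is well defined on pairs of left cosets in (Γ∞⁺\Γ)² with c_{γδ⁻¹} totally positive, and the resulting family is absolutely summable (i.e., the double Eisenstein series E_{s,k−s}(z;w) converges absolutely). -/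

import Mathlib

open Complex

noncomputable section

namespace HilbertPaper

/-- Möbius action of a real 2×2 matrix on a complex number. -/
def moebius (g : Matrix (Fin 2) (Fin 2) ℝ) (z : ℂ) : ℂ :=
  (((g 0 0 : ℝ) : ℂ) * z + ((g 0 1 : ℝ) : ℂ)) / (((g 1 0 : ℝ) : ℂ) * z + ((g 1 1 : ℝ) : ℂ))

/-- Automorphy factor `j(g, z) = c z + d`. -/
def jfac (g : Matrix (Fin 2) (Fin 2) ℝ) (z : ℂ) : ℂ :=
  ((g 1 0 : ℝ) : ℂ) * z + ((g 1 1 : ℝ) : ℂ)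

variable (F : Type) [Field F] [NumberField F]

/-- The embedding of the ring of integers into ℝ induced by a real embedding σ of F. -/
def emb (σ : F →+* ℝ) : NumberField.RingOfIntegers F →+* ℝ :=
  σ.comp (algebraMap (NumberField.RingOfIntegers F) F)

/-- An element of F is totally positive when both real embeddings are positive on it. -/
def TotPos (σ₁ σ₂ : F →+* ℝ) (x : F) : Prop := 0 < σ₁ x ∧ 0 < σ₂ x

/-- `F` is a real quadratic field with narrow class number one, whose two real embeddings
are `σ₁ ≠ σ₂`; narrow class number one is expressed as: every nonzero ideal of the ring of
integers has a totally positive generator. -/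
def RealQuadNarrowOne (σ₁ σ₂ : F →+* ℝ) : Prop :=
  Module.finrank ℚ F = 2 ∧ σ₁ ≠ σ₂ ∧
    ∀ I : Ideal (NumberField.RingOfIntegers F), I ≠ ⊥ →
      ∃ a : NumberField.RingOfIntegers F,
        TotPos F σ₁ σ₂ (algebraMap (NumberField.RingOfIntegers F) F a) ∧ I = Ideal.span {a}

/-- Γ = SL₂(O). -/
abbrev SL2O := Matrix.SpecialLinearGroup (Fin 2) (NumberField.RingOfIntegers F)

/-- The real matrix obtained from γ ∈ SL₂(O) by applying σ entrywise. -/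
def mat (σ : F →+* ℝ) (γ : SL2O F) : Matrix (Fin 2) (Fin 2) ℝ :=
  (γ : Matrix (Fin 2) (Fin 2) (NumberField.RingOfIntegers F)).map (emb F σ)

/-- Membership in the subgroup A = {diag(ε, ε⁻¹) : ε a totally positive unit}. -/
def IsInA (σ₁ σ₂ : F →+* ℝ) (a : SL2O F) : Prop :=
  ∃ ε : (NumberField.RingOfIntegers F)ˣ,
    TotPos F σ₁ σ₂ (algebraMap (NumberField.RingOfIntegers F) F (ε : NumberField.RingOfIntegers F)) ∧
    (a : Matrix (Fin 2) (Fin 2) (NumberField.RingOfIntegers F)) =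
      !![(ε : NumberField.RingOfIntegers F), 0; 0, ((ε⁻¹ : (NumberField.RingOfIntegers F)ˣ) : NumberField.RingOfIntegers F)]

/-- The relation on Γ whose quotient is the coset space A\Γ. -/
def ARel (σ₁ σ₂ : F →+* ℝ) (γ γ' : SL2O F) : Prop :=
  ∃ a : SL2O F, IsInA F σ₁ σ₂ a ∧ γ' = a * γ

/-- The summand of the Cohen kernel: (γ₁z₁)^{-s} (γ₂z₂)^{-s} j(γ,z)^{-k·1}. -/
def cohenSummand (σ₁ σ₂ : F →+* ℝ) (k : ℕ) (s : ℂ) (z₁ z₂ : ℂ) (γ : SL2O F) : ℂ :=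
  moebius (mat F σ₁ γ) z₁ ^ (-s) * moebius (mat F σ₂ γ) z₂ ^ (-s) *
    (jfac (mat F σ₁ γ) z₁ ^ (-(k : ℤ)) * jfac (mat F σ₂ γ) z₂ ^ (-(k : ℤ)))


/-- Membership in Γ∞⁺, the upper-triangular elements of Γ with totally positive diagonal. -/
def IsInGammaInfPos (σ₁ σ₂ : F →+* ℝ) (p : SL2O F) : Prop :=
  (p : Matrix (Fin 2) (Fin 2) (NumberField.RingOfIntegers F)) 1 0 = 0 ∧
  TotPos F σ₁ σ₂ (algebraMap (NumberField.RingOfIntegers F) F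
    ((p : Matrix (Fin 2) (Fin 2) (NumberField.RingOfIntegers F)) 0 0)) ∧
  TotPos F σ₁ σ₂ (algebraMap (NumberField.RingOfIntegers F) F
    ((p : Matrix (Fin 2) (Fin 2) (NumberField.RingOfIntegers F)) 1 1))

/-- The relation on Γ whose quotient is the coset space Γ∞⁺\Γ. -/
def GammaInfRel (σ₁ σ₂ : F →+* ℝ) (γ γ' : SL2O F) : Prop :=
  ∃ p : SL2O F, IsInGammaInfPos F σ₁ σ₂ p ∧ γ' = p * γ

/-- The relation on Γ × Γ whose quotient is (Γ∞⁺\Γ)². -/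
def PairRel (σ₁ σ₂ : F →+* ℝ) (p q : SL2O F × SL2O F) : Prop :=
  GammaInfRel F σ₁ σ₂ p.1 q.1 ∧ GammaInfRel F σ₁ σ₂ p.2 q.2

/-- `c_{γδ⁻¹}`, the lower-left entry of γδ⁻¹. -/
def lowc (γ δ : SL2O F) : NumberField.RingOfIntegers F :=
  ((γ * δ⁻¹ : SL2O F) : Matrix (Fin 2) (Fin 2) (NumberField.RingOfIntegers F)) 1 0

/-- The summand of the double Eisenstein series E_{s, k-s}(z; w). -/
def dblSummand (σ₁ σ₂ : F →+* ℝ) (k : ℕ) (s w : ℂ) (z₁ z₂ : ℂ) (γ δ : SL2O F) : ℂ :=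
  ((σ₁ (algebraMap (NumberField.RingOfIntegers F) F (lowc F γ δ)) : ℝ) : ℂ) ^ (w - 1) *
  ((σ₂ (algebraMap (NumberField.RingOfIntegers F) F (lowc F γ δ)) : ℝ) : ℂ) ^ (w - 1) *
  ((jfac (mat F σ₁ γ) z₁ / jfac (mat F σ₁ δ) z₁) ^ (-s) *
   (jfac (mat F σ₂ γ) z₂ / jfac (mat F σ₂ δ) z₂) ^ (-s)) *
  (jfac (mat F σ₁ δ) z₁ ^ (-(k : ℤ)) * jfac (mat F σ₂ δ) z₂ ^ (-(k : ℤ)))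

open Classical in
/-- The summand of the double Eisenstein series, extended by zero to pairs whose
`c_{γδ⁻¹}` is not totally positive. -/
def dblExt (σ₁ σ₂ : F →+* ℝ) (k : ℕ) (s w : ℂ) (z₁ z₂ : ℂ) (γ δ : SL2O F) : ℂ :=
  if TotPos F σ₁ σ₂ (algebraMap (NumberField.RingOfIntegers F) F (lowc F γ δ)) then
    dblSummand F σ₁ σ₂ k s w z₁ z₂ γ δ
  else 0

section

set_option linter.unusedSectionVars false

variable {F} {σ₁ σ₂ : F →+* ℝ}

lemma emb_mul_emb_eq_intCast (hfin : Module.finrank ℚ F = 2) (hne : σ₁ ≠ σ₂)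
    (x : NumberField.RingOfIntegers F) :
    ∃ n : ℤ, emb F σ₁ x * emb F σ₂ x = n := by
  classical
  let τ₁ : F →ₐ[ℚ] ℂ := (Complex.ofRealHom.comp σ₁).toRatAlgHom
  let τ₂ : F →ₐ[ℚ] ℂ := (Complex.ofRealHom.comp σ₂).toRatAlgHom
  have hτ : τ₁ ≠ τ₂ := by
    intro h
    apply hne
    ext y
    have := DFunLike.congr_fun h y
    exact Complex.ofReal_injective this
  have huniv : ({τ₁, τ₂} : Finset (F →ₐ[ℚ] ℂ)) = Finset.univ := by
    apply Finset.eq_univ_of_card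
    rw [AlgHom.card, hfin, Finset.card_pair hτ]
  have h := Algebra.norm_eq_prod_embeddings ℚ ℂ (algebraMap (NumberField.RingOfIntegers F) F x)
  rw [← huniv, Finset.prod_pair hτ] at h
  refine ⟨Algebra.norm ℤ x, ?_⟩
  have hn : (Algebra.norm ℚ (algebraMap (NumberField.RingOfIntegers F) F x)) =
      ((Algebra.norm ℤ x : ℤ) : ℚ) := (Algebra.coe_norm_int x).symm
  rw [hn] at h
  have h' : ((Algebra.norm ℤ x : ℝ) : ℂ) = ((emb F σ₁ x * emb F σ₂ x : ℝ) : ℂ) := by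
    have h₂ : ((Algebra.norm ℤ x : ℤ) : ℂ) = τ₁ x * τ₂ x := by simpa using h
    rw [Complex.ofReal_mul, Complex.ofReal_intCast]
    exact h₂
  exact (Complex.ofReal_injective h').symm

lemma emb_injective (σ : F →+* ℝ) : Function.Injective (emb F σ) :=
  σ.injective.comp NumberField.RingOfIntegers.coe_injective

lemma one_le_abs_emb_mul_abs_emb (hfin : Module.finrank ℚ F = 2) (hne : σ₁ ≠ σ₂)
    {x : NumberField.RingOfIntegers F} (hx : x ≠ 0) :
    1 ≤ |emb F σ₁ x| * |emb F σ₂ x| := by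
  obtain ⟨n, hn⟩ := emb_mul_emb_eq_intCast hfin hne x
  rw [← abs_mul, hn]
  have hn0 : n ≠ 0 := by
    rintro rfl
    have h0 : emb F σ₁ x * emb F σ₂ x ≠ 0 :=
      mul_ne_zero ((map_ne_zero_iff _ (emb_injective σ₁)).2 hx)
        ((map_ne_zero_iff _ (emb_injective σ₂)).2 hx)
    exact h0 (by simpa using hn)
  exact_mod_cast Int.one_le_abs hn0

lemma emb_mul_emb_eq_one (hfin : Module.finrank ℚ F = 2) (hne : σ₁ ≠ σ₂)
    {x y : NumberField.RingOfIntegers F} (hxy : x * y = 1)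
    (h₁ : 0 < emb F σ₁ x) (h₂ : 0 < emb F σ₂ x) :
    emb F σ₁ x * emb F σ₂ x = 1 := by
  have hx := one_le_abs_emb_mul_abs_emb hfin hne (left_ne_zero_of_mul_eq_one hxy)
  have hy := one_le_abs_emb_mul_abs_emb hfin hne (right_ne_zero_of_mul_eq_one hxy)
  rw [abs_of_pos h₁, abs_of_pos h₂] at hx
  have e₁ : emb F σ₁ x * |emb F σ₁ y| = 1 := by
    rw [← abs_of_pos h₁, ← abs_mul, ← map_mul, hxy]; simp
  have e₂ : emb F σ₂ x * |emb F σ₂ y| = 1 := by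
    rw [← abs_of_pos h₂, ← abs_mul, ← map_mul, hxy]; simp
  have e : (emb F σ₁ x * emb F σ₂ x) * (|emb F σ₁ y| * |emb F σ₂ y|) = 1 := by
    rw [mul_mul_mul_comm, e₁, e₂, one_mul]
  nlinarith

/-- A totally positive unit that is large at `σ₁`. -/
lemma exists_totPos_unit (hfin : Module.finrank ℚ F = 2) (hne : σ₁ ≠ σ₂) :
    ∃ ε : (NumberField.RingOfIntegers F)ˣ,
      1 < emb F σ₁ (ε : NumberField.RingOfIntegers F) ∧
        0 < emb F σ₂ (ε : NumberField.RingOfIntegers F) := by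
  let v₁ := NumberField.InfinitePlace.mk (Complex.ofRealHom.comp σ₁)
  let v₂ := NumberField.InfinitePlace.mk (Complex.ofRealHom.comp σ₂)
  have hconj : ∀ τ : F →+* ℝ, NumberField.ComplexEmbedding.conjugate
      (Complex.ofRealHom.comp τ) = Complex.ofRealHom.comp τ := by
    intro τ; ext y; simp
  have hv : v₂ ≠ v₁ := by
    intro h
    rw [NumberField.InfinitePlace.mk_eq_iff, hconj, or_self] at h
    apply hne
    ext y
    exact (Complex.ofReal_injective (DFunLike.congr_fun h y)).symm
  obtain ⟨u, hu⟩ := NumberField.Units.dirichletUnitTheorem.exists_unit F v₁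
  have h := hu v₂ hv
  have hval : v₂ (u : F) = |emb F σ₂ u| := by
    rw [NumberField.InfinitePlace.apply]
    simp [emb]
  rw [hval] at h
  have hu0 : (u : NumberField.RingOfIntegers F) ≠ 0 := u.ne_zero
  have hpos₂ : 0 < |emb F σ₂ u| := abs_pos.2 ((map_ne_zero_iff _ (emb_injective σ₂)).2 hu0)
  have hpos₁ : 0 < |emb F σ₁ u| := abs_pos.2 ((map_ne_zero_iff _ (emb_injective σ₁)).2 hu0)
  have hlt : |emb F σ₂ u| < 1 := (Real.log_neg_iff hpos₂).1 h
  have hN := one_le_abs_emb_mul_abs_emb hfin hne hu0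
  have hgt : 1 < |emb F σ₁ u| := by nlinarith
  refine ⟨u ^ 2, ?_, ?_⟩
  · rw [Units.val_pow_eq_pow_val, map_pow, ← sq_abs]
    nlinarith
  · rw [Units.val_pow_eq_pow_val, map_pow, ← sq_abs]
    positivity

lemma summable_one_add_emb_rpow (hfin : Module.finrank ℚ F = 2) (hne : σ₁ ≠ σ₂)
    {a : ℝ} (ha : 2 < a) :
    Summable fun x : NumberField.RingOfIntegers F ↦
      (1 + max |emb F σ₁ x| |emb F σ₂ x|) ^ (-a) := by
  classical
  let φ : NumberField.RingOfIntegers F →ₗ[ℤ] ℝ × ℝ :=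
    ((emb F σ₁).toAddMonoidHom.toIntLinearMap).prod ((emb F σ₂).toAddMonoidHom.toIntLinearMap)
  have hinj : Function.Injective φ := fun x y h ↦ emb_injective σ₁ (congrArg Prod.fst h)
  let L : Submodule ℤ (ℝ × ℝ) := LinearMap.range φ
  let e : NumberField.RingOfIntegers F ≃ₗ[ℤ] L := LinearEquiv.ofInjective φ hinj
  have hrank : Module.finrank ℤ L = 2 := by
    rw [← e.finrank_eq, NumberField.RingOfIntegers.rank, hfin]
  have hnorm : ∀ x, ‖e x‖ = max |emb F σ₁ x| |emb F σ₂ x| := fun x ↦ rfl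
  have : DiscreteTopology L := by
    refine discreteTopology_of_isOpen_singleton_zero ?_
    convert! (Metric.isOpen_ball : IsOpen (Metric.ball (0 : L) 1))
    ext y
    simp only [Set.mem_singleton_iff, mem_ball_zero_iff]
    refine ⟨fun h ↦ by simp [h], fun h ↦ ?_⟩
    obtain ⟨x, rfl⟩ := e.surjective y
    by_contra hx
    have hx0 : x ≠ 0 := fun h0 ↦ hx (by rw [h0, map_zero])
    rw [hnorm, max_lt_iff] at h
    have := one_le_abs_emb_mul_abs_emb hfin hne hx0
    nlinarith [abs_nonneg (emb F σ₁ x), abs_nonneg (emb F σ₂ x)]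
  have hsum := ZLattice.summable_norm_rpow L (-a) (by rw [hrank]; push_cast; linarith)
  have hsum' : Summable fun x : NumberField.RingOfIntegers F ↦ ‖e x‖ ^ (-a) :=
    (e.toEquiv.summable_iff (f := fun y : L ↦ ‖y‖ ^ (-a))).2 hsum
  refine Summable.of_norm_bounded_eventually hsum' ?_
  refine (Set.finite_singleton (0 : NumberField.RingOfIntegers F)).subset fun x hx ↦ ?_
  by_contra hx0
  refine hx ?_
  have hpos : 0 < ‖e x‖ := norm_pos_iff.2 fun h ↦ hx0 (e.map_eq_zero_iff.1 h)
  rw [Set.mem_ofPred_eq, ← hnorm, Real.norm_of_nonneg (by positivity)]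
  exact Real.rpow_le_rpow_of_nonpos hpos (by linarith) (by linarith)

lemma det_eq_one (γ : SL2O F) : γ.1 0 0 * γ.1 1 1 - γ.1 0 1 * γ.1 1 0 = 1 := by
  rw [← Matrix.det_fin_two]
  exact γ.2

lemma lowc_eq (γ δ : SL2O F) : lowc F γ δ = γ.1 1 0 * δ.1 1 1 - γ.1 1 1 * δ.1 1 0 := by
  simp [lowc, Matrix.SpecialLinearGroup.coe_inv, Matrix.adjugate_fin_two, Matrix.mul_apply,
    Fin.sum_univ_two]
  ring

lemma mul_row_of_lower_zero {p : SL2O F} (hp : p.1 1 0 = 0) (γ : SL2O F) (i : Fin 2) :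
    (p * γ).1 1 i = p.1 1 1 * γ.1 1 i := by
  simp [Matrix.mul_apply, Fin.sum_univ_two, hp]

lemma jfac_eq (σ : F →+* ℝ) (γ : SL2O F) (z : ℂ) :
    jfac (mat F σ γ) z = (emb F σ (γ.1 1 0) : ℂ) * z + (emb F σ (γ.1 1 1) : ℂ) := rfl

lemma jfac_mul {p : SL2O F} (hp : p.1 1 0 = 0) (σ : F →+* ℝ) (γ : SL2O F) (z : ℂ) :
    jfac (mat F σ (p * γ)) z = (emb F σ (p.1 1 1) : ℂ) * jfac (mat F σ γ) z := by
  rw [jfac_eq, jfac_eq, mul_row_of_lower_zero hp, mul_row_of_lower_zero hp]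
  push_cast [map_mul]
  ring

lemma lowc_mul {p q : SL2O F} (hp : p.1 1 0 = 0) (hq : q.1 1 0 = 0) (γ δ : SL2O F) :
    lowc F (p * γ) (q * δ) = p.1 1 1 * q.1 1 1 * lowc F γ δ := by
  simp only [lowc_eq, mul_row_of_lower_zero hp, mul_row_of_lower_zero hq]
  ring

/-- The left action of diagonal factors of norm one does not change the summand. -/
lemma summand_scale {a₁ a₂ b₁ b₂ c₁ c₂ : ℝ} (ha₁ : 0 < a₁) (ha₂ : 0 < a₂) (hb₁ : 0 < b₁)
    (hb₂ : 0 < b₂) (ha : a₁ * a₂ = 1) (hb : b₁ * b₂ = 1) (hc₁ : 0 < c₁) (hc₂ : 0 < c₂)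
    (k : ℕ) (s w x₁ x₂ y₁ y₂ : ℂ) :
    ((a₁ * b₁ * c₁ : ℝ) : ℂ) ^ (w - 1) * ((a₂ * b₂ * c₂ : ℝ) : ℂ) ^ (w - 1) *
      (((a₁ * x₁) / (b₁ * y₁)) ^ (-s) * ((a₂ * x₂) / (b₂ * y₂)) ^ (-s)) *
      ((b₁ * y₁) ^ (-(k : ℤ)) * (b₂ * y₂) ^ (-(k : ℤ))) =
    (c₁ : ℂ) ^ (w - 1) * (c₂ : ℂ) ^ (w - 1) * ((x₁ / y₁) ^ (-s) * (x₂ / y₂) ^ (-s)) *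
      (y₁ ^ (-(k : ℤ)) * y₂ ^ (-(k : ℤ))) := by
  have hc : ((a₁ * b₁ * c₁ : ℝ) : ℂ) ^ (w - 1) * ((a₂ * b₂ * c₂ : ℝ) : ℂ) ^ (w - 1) =
      (c₁ : ℂ) ^ (w - 1) * (c₂ : ℂ) ^ (w - 1) := by
    rw [← Complex.mul_cpow_ofReal_nonneg (by positivity) (by positivity),
      ← Complex.mul_cpow_ofReal_nonneg hc₁.le hc₂.le, ← Complex.ofReal_mul, ← Complex.ofReal_mul]
    congr 2
    linear_combination c₁ * c₂ * (b₁ * b₂) * ha + c₁ * c₂ * hb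
  have real_mul : ∀ {r : ℝ} (_ : 0 < r) (x : ℂ),
      ((r : ℂ) * x) ^ (-s) = (r : ℂ) ^ (-s) * x ^ (-s) := by
    intro r hr x
    have hr' : (r : ℂ) ≠ 0 := Complex.ofReal_ne_zero.2 hr.ne'
    rcases eq_or_ne x 0 with rfl | hx
    · rcases eq_or_ne s 0 with rfl | hs
      · simp
      · simp [Complex.zero_cpow (neg_ne_zero.2 hs)]
    · rw [Complex.cpow_def_of_ne_zero (mul_ne_zero hr' hx), Complex.cpow_def_of_ne_zero hr',
        Complex.cpow_def_of_ne_zero hx, Complex.log_ofReal_mul hr hx, Complex.ofReal_log hr.le,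
        add_mul, Complex.exp_add]
  have hj : ((a₁ * x₁) / (b₁ * y₁)) ^ (-s) * ((a₂ * x₂) / (b₂ * y₂)) ^ (-s) =
      (x₁ / y₁) ^ (-s) * (x₂ / y₂) ^ (-s) := by
    have e₁ : (a₁ * x₁) / (b₁ * y₁) = ((a₁ / b₁ : ℝ) : ℂ) * (x₁ / y₁) := by
      push_cast; rw [mul_div_mul_comm]
    have e₂ : (a₂ * x₂) / (b₂ * y₂) = ((a₂ / b₂ : ℝ) : ℂ) * (x₂ / y₂) := by
      push_cast; rw [mul_div_mul_comm]
    rw [e₁, e₂, real_mul (by positivity), real_mul (by positivity), mul_mul_mul_comm,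
      ← Complex.mul_cpow_ofReal_nonneg (by positivity) (by positivity), ← Complex.ofReal_mul,
      div_mul_div_comm, ha, hb]
    simp
  have hk : (b₁ * y₁) ^ (-(k : ℤ)) * (b₂ * y₂) ^ (-(k : ℤ)) =
      y₁ ^ (-(k : ℤ)) * y₂ ^ (-(k : ℤ)) := by
    rw [mul_zpow, mul_zpow, mul_mul_mul_comm, ← mul_zpow, ← Complex.ofReal_mul, hb]
    simp
  rw [hc, hj, hk]

/-- The summand of the double Eisenstein series only depends on the pair of cosets. -/
lemma dblExt_eq_of_pairRel (hfin : Module.finrank ℚ F = 2) (hne : σ₁ ≠ σ₂) (k : ℕ)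
    (s w z₁ z₂ : ℂ) {x y : SL2O F × SL2O F} (h : PairRel F σ₁ σ₂ x y) :
    dblExt F σ₁ σ₂ k s w z₁ z₂ x.1 x.2 = dblExt F σ₁ σ₂ k s w z₁ z₂ y.1 y.2 := by
  obtain ⟨γ, δ⟩ := x
  obtain ⟨γ', δ'⟩ := y
  obtain ⟨⟨p, ⟨hp, -, hp₁, hp₂⟩, hpγ⟩, ⟨q, ⟨hq, -, hq₁, hq₂⟩, hqδ⟩⟩ := h
  dsimp only at hpγ hqδ ⊢
  subst hpγ hqδ
  have hpu : p.1 1 1 * p.1 0 0 = 1 := by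
    have := det_eq_one p
    rw [hp, mul_zero, sub_zero] at this
    rw [mul_comm, this]
  have hqu : q.1 1 1 * q.1 0 0 = 1 := by
    have := det_eq_one q
    rw [hq, mul_zero, sub_zero] at this
    rw [mul_comm, this]
  have hpn := emb_mul_emb_eq_one hfin hne hpu hp₁ hp₂
  have hqn := emb_mul_emb_eq_one hfin hne hqu hq₁ hq₂
  have hlow : ∀ σ : F →+* ℝ, σ (algebraMap (NumberField.RingOfIntegers F) F
      (lowc F (p * γ) (q * δ))) = emb F σ (p.1 1 1) * emb F σ (q.1 1 1) *
        σ (algebraMap (NumberField.RingOfIntegers F) F (lowc F γ δ)) := by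
    intro σ
    rw [lowc_mul hp hq]
    simp [emb]
  have hpos : TotPos F σ₁ σ₂ (algebraMap (NumberField.RingOfIntegers F) F
      (lowc F (p * γ) (q * δ))) ↔
      TotPos F σ₁ σ₂ (algebraMap (NumberField.RingOfIntegers F) F (lowc F γ δ)) := by
    unfold TotPos
    rw [hlow, hlow]
    exact and_congr (mul_pos_iff_of_pos_left (mul_pos hp₁ hq₁))
      (mul_pos_iff_of_pos_left (mul_pos hp₂ hq₂))
  unfold dblExt
  by_cases hc : TotPos F σ₁ σ₂ (algebraMap (NumberField.RingOfIntegers F) F (lowc F γ δ))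
  · rw [if_pos hc, if_pos (hpos.2 hc)]
    unfold dblSummand
    simp only [hlow, jfac_mul hp, jfac_mul hq]
    exact (summand_scale hp₁ hp₂ hq₁ hq₂ hpn hqn hc.1 hc.2 k s w _ _ _ _).symm
  · rw [if_neg hc, if_neg (mt hpos.1 hc)]

/-- Two elements of `Γ` with the same lower row lie in the same coset of `Γ∞⁺`. -/
lemma gammaInfRel_of_row_eq (σ₁ σ₂ : F →+* ℝ) {γ γ' : SL2O F} (h₀ : γ.1 1 0 = γ'.1 1 0)
    (h₁ : γ.1 1 1 = γ'.1 1 1) : GammaInfRel F σ₁ σ₂ γ γ' := by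
  have h10 : (γ' * γ⁻¹).1 1 0 = 0 := by
    have := lowc_eq γ' γ
    unfold lowc at this
    rw [this, h₀, h₁]
    ring
  have h11 : (γ' * γ⁻¹).1 1 1 = 1 := by
    refine Eq.trans ?_ (det_eq_one γ)
    rw [h₀, h₁]
    simp [Matrix.SpecialLinearGroup.coe_inv, Matrix.adjugate_fin_two, Matrix.mul_apply,
      Fin.sum_univ_two]
    ring
  have h00 : (γ' * γ⁻¹).1 0 0 = 1 := by
    have := det_eq_one (γ' * γ⁻¹)
    rwa [h10, h11, mul_one, mul_zero, sub_zero] at this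
  refine ⟨γ' * γ⁻¹, ⟨h10, ?_, ?_⟩, by simp⟩
  · rw [h00]; simp [TotPos]
  · rw [h11]; simp [TotPos]

/-- The size of the lower row of `γ` under the embedding `σ`. -/
def rowSize (σ : F →+* ℝ) (γ : SL2O F) : ℝ := |emb F σ (γ.1 1 0)| + |emb F σ (γ.1 1 1)|

lemma rowSize_mul {p : SL2O F} (hp : p.1 1 0 = 0) (σ : F →+* ℝ) (γ : SL2O F) :
    rowSize σ (p * γ) = |emb F σ (p.1 1 1)| * rowSize σ γ := by
  unfold rowSize
  rw [mul_row_of_lower_zero hp, mul_row_of_lower_zero hp, map_mul, map_mul, abs_mul, abs_mul]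
  ring

lemma one_le_rowSize_mul (hfin : Module.finrank ℚ F = 2) (hne : σ₁ ≠ σ₂) (γ : SL2O F) :
    1 ≤ rowSize σ₁ γ * rowSize σ₂ γ := by
  unfold rowSize
  have hd := det_eq_one γ
  have a₁ := abs_nonneg (emb F σ₁ (γ.1 1 0))
  have a₂ := abs_nonneg (emb F σ₁ (γ.1 1 1))
  have a₃ := abs_nonneg (emb F σ₂ (γ.1 1 0))
  have a₄ := abs_nonneg (emb F σ₂ (γ.1 1 1))
  by_cases h : γ.1 1 0 = 0
  · have h' : γ.1 1 1 ≠ 0 := by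
      intro h'
      rw [h, h'] at hd
      simp at hd
    have := one_le_abs_emb_mul_abs_emb hfin hne h'
    nlinarith [mul_nonneg a₁ a₃, mul_nonneg a₁ a₄, mul_nonneg a₂ a₃]
  · have := one_le_abs_emb_mul_abs_emb hfin hne h
    nlinarith [mul_nonneg a₂ a₄, mul_nonneg a₁ a₄, mul_nonneg a₂ a₃]

lemma rowSize_pos (hfin : Module.finrank ℚ F = 2) (hne : σ₁ ≠ σ₂) (γ : SL2O F) :
    0 < rowSize σ₁ γ ∧ 0 < rowSize σ₂ γ := by
  have h := one_le_rowSize_mul hfin hne γ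
  have h₁ : 0 ≤ rowSize σ₁ γ := by unfold rowSize; positivity
  have h₂ : 0 ≤ rowSize σ₂ γ := by unfold rowSize; positivity
  constructor <;> nlinarith

/-- Every coset has a representative whose lower row has comparable sizes at both places. -/
lemma exists_balanced (hfin : Module.finrank ℚ F = 2) (hne : σ₁ ≠ σ₂) :
    ∃ K : ℝ, 1 ≤ K ∧ ∀ γ : SL2O F, ∃ γ' : SL2O F, GammaInfRel F σ₁ σ₂ γ γ' ∧
      rowSize σ₁ γ' ≤ K * rowSize σ₂ γ' ∧ rowSize σ₂ γ' ≤ K * rowSize σ₁ γ' := by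
  obtain ⟨ε, hε₁, hε₂⟩ := exists_totPos_unit hfin hne
  have hε₀ : 0 < emb F σ₁ (ε : NumberField.RingOfIntegers F) := one_pos.trans hε₁
  have hN := emb_mul_emb_eq_one hfin hne ε.mul_inv hε₀ hε₂
  set t := emb F σ₁ (ε : NumberField.RingOfIntegers F) with ht
  refine ⟨t ^ 2, by nlinarith, fun γ ↦ ?_⟩
  obtain ⟨hr₁, hr₂⟩ := rowSize_pos hfin hne γ
  obtain ⟨n, hn₁, hn₂⟩ := exists_mem_Ico_zpow (div_pos hr₂ hr₁)
    (show 1 < t ^ 2 by nlinarith)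
  have hz : ∀ (σ : F →+* ℝ) (m : ℤ),
      emb F σ ((ε ^ m : (NumberField.RingOfIntegers F)ˣ) : NumberField.RingOfIntegers F) =
        (emb F σ (ε : NumberField.RingOfIntegers F)) ^ m := by
    intro σ m
    calc _ = ((Units.map (emb F σ).toMonoidHom (ε ^ m) : ℝˣ) : ℝ) := rfl
      _ = _ := by rw [map_zpow, Units.val_zpow_eq_zpow_val]; rfl
  let p : SL2O F := ⟨!![((ε ^ (-n) : (NumberField.RingOfIntegers F)ˣ) :
      NumberField.RingOfIntegers F), 0; 0, ((ε ^ n : (NumberField.RingOfIntegers F)ˣ) :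
      NumberField.RingOfIntegers F)], by
    rw [Matrix.det_fin_two_of, mul_zero, sub_zero, ← Units.val_mul, ← zpow_add]
    simp⟩
  have hp10 : p.1 1 0 = 0 := rfl
  have hp11 : p.1 1 1 = ((ε ^ n : (NumberField.RingOfIntegers F)ˣ) :
    NumberField.RingOfIntegers F) := rfl
  have hp00 : p.1 0 0 = ((ε ^ (-n) : (NumberField.RingOfIntegers F)ˣ) :
    NumberField.RingOfIntegers F) := rfl
  have hpos : ∀ m : ℤ, TotPos F σ₁ σ₂ (algebraMap (NumberField.RingOfIntegers F) F
      ((ε ^ m : (NumberField.RingOfIntegers F)ˣ) : NumberField.RingOfIntegers F)) := by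
    intro m
    constructor
    · change 0 < emb F σ₁ _
      rw [hz]; exact zpow_pos hε₀ m
    · change 0 < emb F σ₂ _
      rw [hz]; exact zpow_pos hε₂ m
  refine ⟨p * γ, ⟨p, ⟨hp10, ?_, ?_⟩, rfl⟩, ?_⟩
  · rw [hp00]; exact hpos _
  · rw [hp11]; exact hpos _
  have ht₂ : emb F σ₂ (ε : NumberField.RingOfIntegers F) = t⁻¹ := eq_inv_of_mul_eq_one_right hN
  rw [rowSize_mul hp10, rowSize_mul hp10, hp11, hz, hz, ht₂, ← ht, abs_of_pos (zpow_pos hε₀ n),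
    abs_of_pos (zpow_pos (inv_pos.2 hε₀) n), inv_zpow]
  have hT : 0 < t ^ n := zpow_pos hε₀ n
  have e : (t ^ 2) ^ n = t ^ n * t ^ n := by rw [sq, mul_zpow]
  rw [le_div_iff₀ hr₁, e] at hn₁
  rw [div_lt_iff₀ hr₁, zpow_add₀ (by positivity), zpow_one, e] at hn₂
  have c₁ : t ^ n * rowSize σ₁ γ ≤ (t ^ n)⁻¹ * rowSize σ₂ γ := by
    rw [← div_eq_inv_mul, le_div_iff₀ hT]
    linarith
  have c₂ : (t ^ n)⁻¹ * rowSize σ₂ γ ≤ t ^ 2 * (t ^ n * rowSize σ₁ γ) := by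
    rw [← div_eq_inv_mul, div_le_iff₀ hT]
    linarith
  refine ⟨c₁.trans ?_, c₂⟩
  exact le_mul_of_one_le_left (by positivity) (by nlinarith)

lemma rowSize_le_norm_jfac (σ : F →+* ℝ) {z : ℂ} (hz : 0 < z.im) :
    ∃ M : ℝ, 0 < M ∧ ∀ γ : SL2O F, rowSize σ γ ≤ M * ‖jfac (mat F σ γ) z‖ := by
  refine ⟨(1 + ‖z‖) / z.im + 1, by positivity, fun γ ↦ ?_⟩
  rw [jfac_eq]
  unfold rowSize
  set c := emb F σ (γ.1 1 0)
  set d := emb F σ (γ.1 1 1)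
  have h₁ : |c| * z.im ≤ ‖(c : ℂ) * z + d‖ := by
    have := Complex.abs_im_le_norm ((c : ℂ) * z + d)
    simpa [abs_mul, abs_of_pos hz] using this
  have h₂ : |d| ≤ ‖(c : ℂ) * z + d‖ + |c| * ‖z‖ := by
    have := norm_sub_le ((c : ℂ) * z + d) (c * z)
    simpa using this
  have h₃ : |c| ≤ ‖(c : ℂ) * z + d‖ / z.im := by rwa [le_div_iff₀ hz]
  calc |c| + |d| ≤ |c| * (1 + ‖z‖) + ‖(c : ℂ) * z + d‖ := by linarith
    _ ≤ ‖(c : ℂ) * z + d‖ / z.im * (1 + ‖z‖) + ‖(c : ℂ) * z + d‖ := by gcongr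
    _ = _ := by ring

lemma norm_cpow_le_exp_mul_rpow {x : ℂ} (hx : x ≠ 0) (s : ℂ) :
    ‖x ^ s‖ ≤ Real.exp (Real.pi * |s.im|) * ‖x‖ ^ s.re := by
  rw [Complex.norm_cpow_of_ne_zero hx, div_eq_mul_inv, ← Real.exp_neg, mul_comm]
  gcongr
  calc -(x.arg * s.im) ≤ |x.arg * s.im| := neg_le_abs _
    _ = |x.arg| * |s.im| := abs_mul _ _
    _ ≤ _ := by gcongr; exact Complex.abs_arg_le_pi x

lemma abs_lowc_le (σ : F →+* ℝ) (γ δ : SL2O F) :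
    |emb F σ (lowc F γ δ)| ≤ rowSize σ γ * rowSize σ δ := by
  rw [lowc_eq, map_sub, map_mul, map_mul]
  unfold rowSize
  refine (abs_sub _ _).trans ?_
  rw [abs_mul, abs_mul]
  nlinarith [mul_nonneg (abs_nonneg (emb F σ (γ.1 1 0))) (abs_nonneg (emb F σ (δ.1 1 0))),
    mul_nonneg (abs_nonneg (emb F σ (γ.1 1 1))) (abs_nonneg (emb F σ (δ.1 1 1)))]

/-- Bound for one of the two factors of the automorphy part of the summand. -/
lemma norm_cpow_div_mul_zpow_le {x y s : ℂ} {k : ℕ} {r t M : ℝ} (hr : 0 < r) (ht : 0 < t)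
    (hM : 0 < M) (hx : r ≤ M * ‖x‖) (hy : t ≤ M * ‖y‖) (hs : 0 ≤ s.re) (hsk : s.re ≤ k) :
    ‖(x / y) ^ (-s) * y ^ (-(k : ℤ))‖ ≤
      Real.exp (Real.pi * |s.im|) * M ^ (k : ℝ) * (r ^ (-s.re) * t ^ (s.re - k)) := by
  have hx₀ : 0 < ‖x‖ := pos_of_mul_pos_right (hr.trans_le hx) hM.le
  have hy₀ : 0 < ‖y‖ := pos_of_mul_pos_right (ht.trans_le hy) hM.le
  have h₁ := norm_cpow_le_exp_mul_rpow (div_ne_zero (norm_pos_iff.1 hx₀) (norm_pos_iff.1 hy₀)) (-s)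
  rw [Complex.neg_im, abs_neg, Complex.neg_re, norm_div] at h₁
  have h₂ : ‖y ^ (-(k : ℤ))‖ = ‖y‖ ^ (-(k : ℝ)) := by
    rw [norm_zpow, ← Real.rpow_intCast]; simp
  have h₃ : (‖x‖ / ‖y‖) ^ (-s.re) * ‖y‖ ^ (-(k : ℝ)) = ‖x‖ ^ (-s.re) * ‖y‖ ^ (s.re - k) := by
    rw [Real.div_rpow hx₀.le hy₀.le, div_eq_mul_inv, ← Real.rpow_neg hy₀.le, neg_neg, mul_assoc,
      ← Real.rpow_add hy₀, sub_eq_add_neg]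
  have h₄ : ‖x‖ ^ (-s.re) ≤ M ^ s.re * r ^ (-s.re) := by
    calc ‖x‖ ^ (-s.re) ≤ (r / M) ^ (-s.re) :=
          Real.rpow_le_rpow_of_nonpos (by positivity) (by rwa [div_le_iff₀' hM]) (by linarith)
      _ = _ := by
          rw [Real.div_rpow hr.le hM.le, Real.rpow_neg hM.le, div_inv_eq_mul, mul_comm]
  have h₅ : ‖y‖ ^ (s.re - k) ≤ M ^ (k - s.re) * t ^ (s.re - k) := by
    calc ‖y‖ ^ (s.re - k) ≤ (t / M) ^ (s.re - k) :=
          Real.rpow_le_rpow_of_nonpos (by positivity) (by rwa [div_le_iff₀' hM]) (by linarith)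
      _ = _ := by
          rw [Real.div_rpow ht.le hM.le, ← neg_sub (k : ℝ) s.re, Real.rpow_neg hM.le,
            div_inv_eq_mul, mul_comm]
  calc _ ≤ Real.exp (Real.pi * |s.im|) * (‖x‖ / ‖y‖) ^ (-s.re) * ‖y‖ ^ (-(k : ℝ)) := by
        rw [norm_mul, h₂]; gcongr
    _ = Real.exp (Real.pi * |s.im|) * (‖x‖ ^ (-s.re) * ‖y‖ ^ (s.re - k)) := by
        rw [mul_assoc, h₃]
    _ ≤ Real.exp (Real.pi * |s.im|) *
        ((M ^ s.re * r ^ (-s.re)) * (M ^ (k - s.re) * t ^ (s.re - k))) := by gcongr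
    _ = _ := by
        rw [mul_mul_mul_comm, ← Real.rpow_add hM, add_sub_cancel, mul_assoc]

/-- The summand is dominated by a product of summands of two Eisenstein series. -/
lemma norm_dblExt_le (hfin : Module.finrank ℚ F = 2) (hne : σ₁ ≠ σ₂) {k : ℕ} {s w z₁ z₂ : ℂ}
    (hs : 0 ≤ s.re) (hsk : s.re ≤ k) (hz₁ : 0 < z₁.im) (hz₂ : 0 < z₂.im) {v : ℝ} (hv : 0 ≤ v)
    (hwv : w.re - 1 ≤ v) :
    ∃ C : ℝ, 0 ≤ C ∧ ∀ γ δ : SL2O F, ‖dblExt F σ₁ σ₂ k s w z₁ z₂ γ δ‖ ≤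
      C * ((rowSize σ₁ γ * rowSize σ₂ γ) ^ (-(s.re - v)) *
        (rowSize σ₁ δ * rowSize σ₂ δ) ^ (-(k - s.re - v))) := by
  obtain ⟨M₁, hM₁, hj₁⟩ := rowSize_le_norm_jfac σ₁ hz₁
  obtain ⟨M₂, hM₂, hj₂⟩ := rowSize_le_norm_jfac σ₂ hz₂
  set E := Real.exp (Real.pi * |s.im|)
  have hE : 0 < E := Real.exp_pos _
  refine ⟨(E * M₁ ^ (k : ℝ)) * (E * M₂ ^ (k : ℝ)), by positivity, fun γ δ ↦ ?_⟩
  obtain ⟨hr₁, hr₂⟩ := rowSize_pos hfin hne γ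
  obtain ⟨ht₁, ht₂⟩ := rowSize_pos hfin hne δ
  unfold dblExt
  split_ifs with hc
  swap
  · rw [norm_zero]; positivity
  have hc₁ : 0 < emb F σ₁ (lowc F γ δ) := hc.1
  have hc₂ : 0 < emb F σ₂ (lowc F γ δ) := hc.2
  have hc₀ : lowc F γ δ ≠ 0 := by
    intro h
    rw [h, map_zero] at hc₁
    exact hc₁.false
  have hN := one_le_abs_emb_mul_abs_emb hfin hne hc₀
  have hB₁ := abs_lowc_le σ₁ γ δ
  have hB₂ := abs_lowc_le σ₂ γ δ
  rw [abs_of_pos hc₁] at hN hB₁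
  rw [abs_of_pos hc₂] at hN hB₂
  have hcpow : ‖((emb F σ₁ (lowc F γ δ) : ℝ) : ℂ) ^ (w - 1) *
      ((emb F σ₂ (lowc F γ δ) : ℝ) : ℂ) ^ (w - 1)‖ ≤
      (rowSize σ₁ γ * rowSize σ₂ γ) ^ v * (rowSize σ₁ δ * rowSize σ₂ δ) ^ v := by
    rw [norm_mul, Complex.norm_cpow_eq_rpow_re_of_pos hc₁,
      Complex.norm_cpow_eq_rpow_re_of_pos hc₂, ← Real.mul_rpow hc₁.le hc₂.le, Complex.sub_re,
      Complex.one_re, ← Real.mul_rpow (by positivity) (by positivity)]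
    calc _ ≤ (emb F σ₁ (lowc F γ δ) * emb F σ₂ (lowc F γ δ)) ^ v :=
          Real.rpow_le_rpow_of_exponent_le hN hwv
      _ ≤ ((rowSize σ₁ γ * rowSize σ₁ δ) * (rowSize σ₂ γ * rowSize σ₂ δ)) ^ v := by gcongr
      _ = _ := by rw [mul_mul_mul_comm]
  have k₁ := norm_cpow_div_mul_zpow_le hr₁ ht₁ hM₁ (hj₁ γ) (hj₁ δ) hs hsk
  have k₂ := norm_cpow_div_mul_zpow_le hr₂ ht₂ hM₂ (hj₂ γ) (hj₂ δ) hs hsk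
  unfold dblSummand
  rw [mul_assoc, mul_mul_mul_comm (_ ^ (-s)), norm_mul, norm_mul (_ ^ (-s) * _)]
  refine (mul_le_mul hcpow (mul_le_mul k₁ k₂ (norm_nonneg _) (by positivity))
    (by positivity) (by positivity)).trans_eq ?_
  have e₁ : (rowSize σ₁ γ * rowSize σ₂ γ) ^ (-(s.re - v)) =
      (rowSize σ₁ γ * rowSize σ₂ γ) ^ v * (rowSize σ₁ γ ^ (-s.re) * rowSize σ₂ γ ^ (-s.re)) := by
    rw [← Real.mul_rpow hr₁.le hr₂.le, ← Real.rpow_add (by positivity)]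
    congr 1; ring
  have e₂ : (rowSize σ₁ δ * rowSize σ₂ δ) ^ (-(k - s.re - v)) =
      (rowSize σ₁ δ * rowSize σ₂ δ) ^ v *
        (rowSize σ₁ δ ^ (s.re - k) * rowSize σ₂ δ ^ (s.re - k)) := by
    rw [← Real.mul_rpow ht₁.le ht₂.le, ← Real.rpow_add (by positivity)]
    congr 1; ring
  rw [e₁, e₂]
  ring

/-- The majorant `(1 + ‖c‖)⁻ᵃ (1 + ‖d‖)⁻ᵃ` on rows `(c, d)`. -/
def rowBound (σ₁ σ₂ : F →+* ℝ) (a : ℝ)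
    (x : NumberField.RingOfIntegers F × NumberField.RingOfIntegers F) : ℝ :=
  (1 + max |emb F σ₁ x.1| |emb F σ₂ x.1|) ^ (-a) * (1 + max |emb F σ₁ x.2| |emb F σ₂ x.2|) ^ (-a)

lemma rowBound_nonneg (a : ℝ) (x : NumberField.RingOfIntegers F × NumberField.RingOfIntegers F) :
    0 ≤ rowBound σ₁ σ₂ a x := by
  unfold rowBound
  positivity

lemma summable_rowBound (hfin : Module.finrank ℚ F = 2) (hne : σ₁ ≠ σ₂) {a : ℝ} (ha : 2 < a) :
    Summable (rowBound σ₁ σ₂ a) :=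
  (summable_one_add_emb_rpow hfin hne ha).mul_of_nonneg (summable_one_add_emb_rpow hfin hne ha)
    (fun _ ↦ by positivity) (fun _ ↦ by positivity)

lemma rowSize_rpow_le_rowBound (hfin : Module.finrank ℚ F = 2) (hne : σ₁ ≠ σ₂) {K a : ℝ}
    (hK : 1 ≤ K) (ha : 0 ≤ a) {γ : SL2O F} (h₁ : rowSize σ₁ γ ≤ K * rowSize σ₂ γ)
    (h₂ : rowSize σ₂ γ ≤ K * rowSize σ₁ γ) :
    (rowSize σ₁ γ * rowSize σ₂ γ) ^ (-a) ≤
      (2 + 2 * K) ^ a * rowBound σ₁ σ₂ a (γ.1 1 0, γ.1 1 1) := by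
  have hR := one_le_rowSize_mul hfin hne γ
  obtain ⟨hr₁, hr₂⟩ := rowSize_pos hfin hne γ
  set R := max (rowSize σ₁ γ) (rowSize σ₂ γ) with hRdef
  have hR₀ : 0 < R := lt_max_of_lt_left hr₁
  have hRsq : R ^ 2 ≤ K * (rowSize σ₁ γ * rowSize σ₂ γ) := by
    rcases max_choice (rowSize σ₁ γ) (rowSize σ₂ γ) with h | h <;> rw [hRdef, h] <;> nlinarith
  have hc : max |emb F σ₁ (γ.1 1 0)| |emb F σ₂ (γ.1 1 0)| ≤ R :=
    max_le_max (le_add_of_nonneg_right (abs_nonneg _)) (le_add_of_nonneg_right (abs_nonneg _))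
  have hd : max |emb F σ₁ (γ.1 1 1)| |emb F σ₂ (γ.1 1 1)| ≤ R :=
    max_le_max (le_add_of_nonneg_left (abs_nonneg _)) (le_add_of_nonneg_left (abs_nonneg _))
  unfold rowBound
  dsimp only
  set C := max |emb F σ₁ (γ.1 1 0)| |emb F σ₂ (γ.1 1 0)|
  set D := max |emb F σ₁ (γ.1 1 1)| |emb F σ₂ (γ.1 1 1)|
  have hC₀ : 0 ≤ C := le_max_of_le_left (abs_nonneg _)
  have hD₀ : 0 ≤ D := le_max_of_le_left (abs_nonneg _)
  have hle : (1 + C) * (1 + D) / (2 + 2 * K) ≤ rowSize σ₁ γ * rowSize σ₂ γ := by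
    rw [div_le_iff₀ (by positivity)]
    calc (1 + C) * (1 + D) ≤ (1 + R) * (1 + R) := by gcongr
      _ ≤ 2 + 2 * R ^ 2 := by nlinarith [sq_nonneg (R - 1)]
      _ ≤ _ := by nlinarith
  calc _ ≤ ((1 + C) * (1 + D) / (2 + 2 * K)) ^ (-a) :=
        Real.rpow_le_rpow_of_nonpos (by positivity) hle (by linarith)
    _ = _ := by
        rw [Real.div_rpow (by positivity) (by positivity),
          Real.mul_rpow (by positivity) (by positivity), Real.rpow_neg (x := 2 + 2 * K)
          (by positivity), div_inv_eq_mul, mul_comm]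

end

/-- For even `k ≥ 6`, `2 < Re s < k - 2`,
`Re w < min (Re s - 1) (k - 1 - Re s)` and `z ∈ ℍ²`, the summand of the double Eisenstein
series (extended by zero off the totally positive locus of `c_{γδ⁻¹}`) is well defined on
pairs of cosets in `(Γ∞⁺\Γ)²`, and every function it induces on the quotient is
(absolutely) summable, i.e. `E_{s,k-s}(z;w)` converges absolutely. -/
theorem statement1 (σ₁ σ₂ : F →+* ℝ) (hF : RealQuadNarrowOne F σ₁ σ₂)
    (k : ℕ) (hkeven : Even k) (hk6 : 6 ≤ k)
    (s w : ℂ) (hs1 : 2 < s.re) (hs2 : s.re < (k : ℝ) - 2)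
    (hw : w.re < min (s.re - 1) ((k : ℝ) - 1 - s.re))
    (z₁ z₂ : ℂ) (hz₁ : 0 < z₁.im) (hz₂ : 0 < z₂.im) :
    (∀ p q : SL2O F × SL2O F, PairRel F σ₁ σ₂ p q →
        dblExt F σ₁ σ₂ k s w z₁ z₂ p.1 p.2 = dblExt F σ₁ σ₂ k s w z₁ z₂ q.1 q.2) ∧
    (∀ f : Quot (PairRel F σ₁ σ₂) → ℂ,
        (∀ p : SL2O F × SL2O F, f (Quot.mk _ p) = dblExt F σ₁ σ₂ k s w z₁ z₂ p.1 p.2) →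
        Summable f) := by
  obtain ⟨hfin, hne, -⟩ := hF
  refine ⟨fun p q h ↦ dblExt_eq_of_pairRel hfin hne k s w z₁ z₂ h, fun f hf ↦ ?_⟩
  obtain ⟨hw₁, hw₂⟩ := lt_min_iff.1 hw
  set v : ℝ := max (w.re - 1) 0 with hvdef
  have hv₀ : 0 ≤ v := le_max_right _ _
  have ha : 2 < s.re - v := by
    rcases max_choice (w.re - 1) 0 with h | h <;> rw [hvdef, h] <;> linarith
  have hb : 2 < k - s.re - v := by
    rcases max_choice (w.re - 1) 0 with h | h <;> rw [hvdef, h] <;> linarith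
  obtain ⟨C, hC, hbound⟩ := norm_dblExt_le hfin hne (k := k) (s := s) (w := w) (by linarith)
    (by linarith) hz₁ hz₂ hv₀ (le_max_left _ _)
  obtain ⟨K, hK, hbal⟩ := exists_balanced hfin hne
  have hrep : ∀ x : Quot (PairRel F σ₁ σ₂), ∃ p : SL2O F × SL2O F, Quot.mk _ p = x ∧
      (rowSize σ₁ p.1 ≤ K * rowSize σ₂ p.1 ∧ rowSize σ₂ p.1 ≤ K * rowSize σ₁ p.1) ∧
      (rowSize σ₁ p.2 ≤ K * rowSize σ₂ p.2 ∧ rowSize σ₂ p.2 ≤ K * rowSize σ₁ p.2) := by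
    intro x
    obtain ⟨⟨γ, δ⟩, rfl⟩ := Quot.exists_rep x
    obtain ⟨γ', hγ, hγ'⟩ := hbal γ
    obtain ⟨δ', hδ, hδ'⟩ := hbal δ
    exact ⟨(γ', δ'), (Quot.sound ⟨hγ, hδ⟩).symm, hγ', hδ'⟩
  choose rep hmk hrep₁ hrep₂ using hrep
  let rows := fun x ↦ (((rep x).1.1 1 0, (rep x).1.1 1 1), ((rep x).2.1 1 0, (rep x).2.1 1 1))
  have hinj : Function.Injective rows := by
    intro x y hxy
    simp only [rows, Prod.mk.injEq] at hxy
    rw [← hmk x, ← hmk y]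
    exact Quot.sound ⟨gammaInfRel_of_row_eq σ₁ σ₂ hxy.1.1 hxy.1.2,
      gammaInfRel_of_row_eq σ₁ σ₂ hxy.2.1 hxy.2.2⟩
  have hsum := ((summable_rowBound hfin hne ha).mul_of_nonneg (summable_rowBound hfin hne hb)
    (rowBound_nonneg _) (rowBound_nonneg _)).comp_injective hinj
  refine Summable.of_norm_bounded
    (hsum.mul_left (C * ((2 + 2 * K) ^ (s.re - v) * (2 + 2 * K) ^ (k - s.re - v)))) fun x ↦ ?_
  obtain ⟨hr₁, hr₂⟩ := rowSize_pos hfin hne (rep x).1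
  obtain ⟨ht₁, ht₂⟩ := rowSize_pos hfin hne (rep x).2
  have e₁ := rowSize_rpow_le_rowBound hfin hne hK (by linarith) (hrep₁ x).1 (hrep₁ x).2
    (a := s.re - v)
  have e₂ := rowSize_rpow_le_rowBound hfin hne hK (by linarith) (hrep₂ x).1 (hrep₂ x).2
    (a := k - s.re - v)
  have hfx : f x = dblExt F σ₁ σ₂ k s w z₁ z₂ (rep x).1 (rep x).2 := by rw [← hf, hmk]
  rw [hfx]
  refine (hbound _ _).trans ?_
  rw [mul_assoc C]
  refine mul_le_mul_of_nonneg_left ?_ hC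
  refine (mul_le_mul e₁ e₂ (by positivity)
    (mul_nonneg (by positivity) (rowBound_nonneg _ _))).trans_eq ?_
  simp only [Function.comp, rows]
  ring

end HilbertPaper
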